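/- arXiv:1508.03134 — 5 statements merged into one kernel-verified Lean document; each statement's English description precedes it below -/
import Mathlib

section
/- Let R be a commutative ring, let u ∈ R, and let a, b, c, d, a' ∈ R with a and a' invertible, satisfying c = a + b − a·b + u·a·b·c, d = a + c − a·c + u·a·c·d, and a'·(a − 1) = a. Then d·a⁻¹ + b·(a')⁻¹ = 2 − c + u·c·(b + d). -/
/-- Identity (eq2lem0) of Lemma 4.1 in the formal group algebra of the hyperbolic
formal group law with `μ₁ = 1`, `μ₂ = −u`: here `a, b, c, d, a'` play the roles of
`y_α, y_β, y_{α+β}, y_{2α+β}, y_{−α}` respectively. -/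
theorem stmt1 {R : Type*} [CommRing R] (u a b c d a' : R) [Invertible a] [Invertible a']
    (h1 : c = a + b - a * b + u * a * b * c)
    (h2 : d = a + c - a * c + u * a * c * d)
    (h3 : a' * (a - 1) = a) :
    d * ⅟a + b * ⅟a' = 2 - c + u * c * (b + d) := by
  have ha : a * ⅟a = 1 := mul_invOf_self a
  have ha' : a' * ⅟a' = 1 := mul_invOf_self a'
  have hinv : ⅟a' = 1 - ⅟a := by
    linear_combination (-(⅟a * ⅟a')) * h3 + (a - 1) * ⅟a * ha' + (1 - ⅟a') * ha
  linear_combination ⅟a * (h1 + h2) + b * hinv + (2 - c + u * c * (b + d) - b) * ha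
end

section
/- Let n ≥ 1 and work in the group algebra ℚ[ℤⁿ] (the Laurent polynomial ring), writing Xᵃ for the basis element corresponding to a ∈ ℤⁿ. Let L be a finite set of nonzero vectors in ℤⁿ such that no two distinct elements of L are ℚ-scalar multiples of each other. If A and B are subsets of L with ∏_{α∈A}(1 − Xᵅ) = ∏_{β∈B}(1 − Xᵝ), then A = B. -/
open Finset

/-- If a group homomorphism `f` into a group with unique sums kills an element of `A` but no element
of `B`, then the products of the `1 - Xᵅ` over `A` and over `B` differ. -/
theorem AddMonoidAlgebra.prod_one_sub_of'_ne {R M N : Type*} [CommRing R] [IsDomain R]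
    [AddCommMonoid M] [AddCommMonoid N] [UniqueSums N] (f : M →+ N) {A B : Finset M} {α : M}
    (hα : α ∈ A) (hfα : f α = 0) (hB : ∀ β ∈ B, f β ≠ 0) :
    ∏ γ ∈ A, (1 - AddMonoidAlgebra.of' R M γ) ≠ ∏ γ ∈ B, (1 - AddMonoidAlgebra.of' R M γ) := by
  intro h
  have hmap (γ : M) : AddMonoidAlgebra.mapDomainRingHom R f (1 - AddMonoidAlgebra.of' R M γ) =
      1 - AddMonoidAlgebra.single (f γ) 1 := by
    rw [map_sub, map_one, AddMonoidAlgebra.of'_apply]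
    simp only [AddMonoidAlgebra.mapDomainRingHom_apply, AddMonoidAlgebra.mapDomain_single]
  have h' := congrArg (AddMonoidAlgebra.mapDomainRingHom R f) h
  simp only [map_prod, hmap] at h'
  rw [prod_eq_zero hα (by rw [hfα, ← AddMonoidAlgebra.one_def, sub_self])] at h'
  obtain ⟨β, hβ, h0⟩ := prod_eq_zero_iff.mp h'.symm
  rw [sub_eq_zero, AddMonoidAlgebra.one_def] at h0
  exact hB β hβ (AddMonoidAlgebra.of_injective (R := R) h0).symm

/-- A nonzero lattice vector `α` is killed by an endomorphism of the lattice whose kernel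
consists of the rational multiples of `α`. -/
theorem exists_addMonoidHom_ker_proportional {ι : Type*} {α : ι → ℤ} (hα : α ≠ 0) :
    ∃ f : (ι → ℤ) →+ (ι → ℤ), f α = 0 ∧
      ∀ β, f β = 0 → ∃ q : ℚ, (fun i => (β i : ℚ)) = q • fun i => (α i : ℚ) := by
  obtain ⟨j, hj⟩ := Function.ne_iff.mp hα
  refine ⟨AddMonoidHom.mk' (fun v => α j • v - v j • α) fun v w => ?_, ?_, fun β hβ => ?_⟩
  · simp only [Pi.add_apply, smul_add, add_smul]
    abel
  · simp
  · refine ⟨β j / α j, funext fun i => ?_⟩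
    have hj' : (α j : ℚ) ≠ 0 := by exact_mod_cast hj
    have hi : α j * β i - β j * α i = 0 := by simpa using congrFun hβ i
    have hi' : (α j : ℚ) * β i - β j * α i = 0 := by exact_mod_cast hi
    simp only [Pi.smul_apply, smul_eq_mul]
    field_simp
    linarith

/-- Over a set of pairwise non-proportional nonzero lattice vectors, the product of the `1 - Xᵅ`
over a subset `A` determines the elements of `A`. -/
theorem subset_of_prod_one_sub_of'_eq {ι : Type*} {L A B : Finset (ι → ℤ)}
    (hne : ∀ α ∈ L, α ≠ 0)
    (hpair : ∀ α ∈ L, ∀ β ∈ L, α ≠ β →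
      ∀ q : ℚ, (fun i => (α i : ℚ)) ≠ q • fun i => (β i : ℚ))
    (hA : A ⊆ L) (hB : B ⊆ L)
    (h : ∏ α ∈ A, (1 - AddMonoidAlgebra.of' ℚ (ι → ℤ) α)
       = ∏ β ∈ B, (1 - AddMonoidAlgebra.of' ℚ (ι → ℤ) β)) : A ⊆ B := by
  intro α hα
  by_contra hαB
  obtain ⟨f, hfα, hf⟩ := exists_addMonoidHom_ker_proportional (hne α (hA hα))
  refine AddMonoidAlgebra.prod_one_sub_of'_ne f hα hfα (fun β hβ hfβ => ?_) h
  obtain ⟨q, hq⟩ := hf β hfβ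
  exact hpair β (hB hβ) α (hA hα) (fun e => hαB (e ▸ hβ)) q hq

/-- Lemma 5.1(1), K-theory case: in the group algebra `ℚ[ℤⁿ]`, a product of the
elements `1 - Xᵅ` over a subset of a set `L` of pairwise non-proportional nonzero
lattice vectors determines the subset. -/
theorem stmt3 (n : ℕ) (hn : 1 ≤ n) (L : Finset (Fin n → ℤ))
    (hne : ∀ α ∈ L, α ≠ 0)
    (hpair : ∀ α ∈ L, ∀ β ∈ L, α ≠ β →
      ∀ q : ℚ, (fun i => (α i : ℚ)) ≠ q • fun i => (β i : ℚ))
    (A B : Finset (Fin n → ℤ)) (hA : A ⊆ L) (hB : B ⊆ L)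
    (h : ∏ α ∈ A, (1 - AddMonoidAlgebra.of' ℚ (Fin n → ℤ) α)
       = ∏ β ∈ B, (1 - AddMonoidAlgebra.of' ℚ (Fin n → ℤ) β)) : A = B := by
  exact (subset_of_prod_one_sub_of'_eq hne hpair hA hB h).antisymm
    (subset_of_prod_one_sub_of'_eq hne hpair hB hA h.symm)
end

section
/- In the Hecke setup, assume in addition the braid relation τ₁τ₂τ₁ = τ₂τ₁τ₂. Then Y₁Y₂Y₁ − Y₂Y₁Y₂ = u·(Y₁ − Y₂). -/
/-- The push-pull element `Y = c⁻¹·(τ + t)` associated to a Hecke generator `τ`,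
where `ci` denotes the inverse `c⁻¹` of `c = t + t⁻¹`. -/
def pushPull {R A : Type*} [CommRing R] [Ring A] [Algebra R A] (t ci : R) (τ : A) : A :=
  algebraMap R A ci * (τ + algebraMap R A t)

/-- The Kazhdan–Lusztig basis identity for `γ = τ + t` in type `A₂`. -/
theorem hecke_add_algebraMap_braid {R A : Type*} [CommRing R] [Ring A] [Algebra R A]
    {t ti : R} (htt : t * ti = 1) {τ₁ τ₂ : A}
    (hq1 : τ₁ ^ 2 = algebraMap R A (ti - t) * τ₁ + 1)
    (hq2 : τ₂ ^ 2 = algebraMap R A (ti - t) * τ₂ + 1)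
    (hbraid : τ₁ * τ₂ * τ₁ = τ₂ * τ₁ * τ₂) :
    (τ₁ + algebraMap R A t) * (τ₂ + algebraMap R A t) * (τ₁ + algebraMap R A t)
      - (τ₂ + algebraMap R A t) * (τ₁ + algebraMap R A t) * (τ₂ + algebraMap R A t)
      = τ₁ - τ₂ := by
  rw [pow_two, ← Algebra.smul_def] at hq1 hq2
  have hcoef : t * (ti - t) + t * t = 1 := by linear_combination htt
  calc
    _ = (τ₁ * τ₂ * τ₁ - τ₂ * τ₁ * τ₂) + t • (τ₁ * τ₁ - τ₂ * τ₂)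
        + (t * t) • (τ₁ - τ₂) := by
      simp only [Algebra.algebraMap_eq_smul_one, add_mul, mul_add, smul_mul_assoc,
        mul_smul_comm, one_mul, mul_one]
      module
    _ = (t * (ti - t) + t * t) • (τ₁ - τ₂) := by
      rw [hbraid, hq1, hq2]
      module
    _ = τ₁ - τ₂ := by rw [hcoef, one_smul]

/-- The twisted braid relation in type `A₂` for the push-pull elements of the
hyperbolic formal Demazure algebra: `Y₁Y₂Y₁ − Y₂Y₁Y₂ = u·(Y₁ − Y₂)` where
`u = c⁻² = ci·ci`. -/
theorem stmt10 {R A : Type*} [CommRing R] [Ring A] [Algebra R A]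
    (t ti ci : R) (htt : t * ti = 1) (hci : (t + ti) * ci = 1)
    (τ₁ τ₂ : A)
    (hq1 : τ₁ ^ 2 = algebraMap R A (ti - t) * τ₁ + 1)
    (hq2 : τ₂ ^ 2 = algebraMap R A (ti - t) * τ₂ + 1)
    (hbraid : τ₁ * τ₂ * τ₁ = τ₂ * τ₁ * τ₂) :
    pushPull t ci τ₁ * pushPull t ci τ₂ * pushPull t ci τ₁
      - pushPull t ci τ₂ * pushPull t ci τ₁ * pushPull t ci τ₂
      = algebraMap R A (ci * ci) * (pushPull t ci τ₁ - pushPull t ci τ₂) := by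
  have h := hecke_add_algebraMap_braid htt hq1 hq2 hbraid
  simp only [pushPull, ← Algebra.smul_def, smul_mul_assoc, mul_smul_comm, ← smul_sub,
    add_sub_add_right_eq_sub, h, mul_smul]
end

section
/- In the Hecke setup, assume in addition the braid relation τ₁τ₂τ₁τ₂ = τ₂τ₁τ₂τ₁. Then Y₁Y₂Y₁Y₂ − Y₂Y₁Y₂Y₁ = 2u·(Y₁Y₂ − Y₂Y₁). -/
theorem pushPull_eq_smul {R A : Type*} [CommRing R] [Ring A] [Algebra R A] (t ci : R) (τ : A) :
    pushPull t ci τ = ci • (τ + t • (1 : A)) := by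
  rw [pushPull, Algebra.smul_def, Algebra.algebraMap_eq_smul_one t]

/-- The commutator form of the Kazhdan–Lusztig basis identity
`γ_{w∘} = γ₁γ₂γ₁γ₂ − 2γ₁γ₂` in the Hecke algebra of the dihedral group of order 8, with `γᵢ = τᵢ + t`. -/
theorem hecke_braid_add_smul_one {R A : Type*} [CommRing R] [Ring A] [Algebra R A]
    {t ti : R} (htt : t * ti = 1) {a b : A}
    (ha : a * a = (ti - t) • a + 1) (hb : b * b = (ti - t) • b + 1)
    (hbraid : a * b * a * b = b * a * b * a) :
    (a + t • (1 : A)) * (b + t • (1 : A)) * (a + t • (1 : A)) * (b + t • (1 : A))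
      - (b + t • (1 : A)) * (a + t • (1 : A)) * (b + t • (1 : A)) * (a + t • (1 : A))
      = (2 : R) • ((a + t • (1 : A)) * (b + t • (1 : A))
          - (b + t • (1 : A)) * (a + t • (1 : A))) := by
  have habb : a * b * b = (ti - t) • (a * b) + a := by
    rw [mul_assoc, hb, mul_add, mul_smul_comm, mul_one]
  have hbaa : b * a * a = (ti - t) • (b * a) + b := by
    rw [mul_assoc, ha, mul_add, mul_smul_comm, mul_one]
  simp only [add_mul, mul_add, smul_mul_assoc, mul_smul_comm, one_mul, mul_one, smul_add,
    ha, hb, habb, hbaa, hbraid]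
  match_scalars <;> first | ring1 | linear_combination 2 * htt | linear_combination (-2) * htt

/-- The twisted braid relation in type `B₂` for the push-pull elements of the
hyperbolic formal Demazure algebra: `Y₁Y₂Y₁Y₂ − Y₂Y₁Y₂Y₁ = 2u·(Y₁Y₂ − Y₂Y₁)` where
`u = c⁻² = ci·ci`. -/
theorem stmt11 {R A : Type*} [CommRing R] [Ring A] [Algebra R A]
    (t ti ci : R) (htt : t * ti = 1) (hci : (t + ti) * ci = 1)
    (τ₁ τ₂ : A)
    (hq1 : τ₁ ^ 2 = algebraMap R A (ti - t) * τ₁ + 1)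
    (hq2 : τ₂ ^ 2 = algebraMap R A (ti - t) * τ₂ + 1)
    (hbraid : τ₁ * τ₂ * τ₁ * τ₂ = τ₂ * τ₁ * τ₂ * τ₁) :
    pushPull t ci τ₁ * pushPull t ci τ₂ * pushPull t ci τ₁ * pushPull t ci τ₂
      - pushPull t ci τ₂ * pushPull t ci τ₁ * pushPull t ci τ₂ * pushPull t ci τ₁
      = 2 * algebraMap R A (ci * ci) *
          (pushPull t ci τ₁ * pushPull t ci τ₂ - pushPull t ci τ₂ * pushPull t ci τ₁) := by
  simp only [pow_two, ← Algebra.smul_def] at hq1 hq2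
  have key := hecke_braid_add_smul_one htt hq1 hq2 hbraid
  have h2 : (2 : A) * algebraMap R A (ci * ci) = algebraMap R A (2 * (ci * ci)) := by
    rw [map_mul _ 2, map_ofNat]
  rw [h2, ← Algebra.smul_def]
  simp only [pushPull_eq_smul, smul_mul_assoc, mul_smul_comm, smul_smul, ← smul_sub, key]
  congr 1
  ring
end

section
/- In the Hecke setup, assume in addition the braid relation (τ₁τ₂)³ = (τ₂τ₁)³ (i.e. τ₁τ₂τ₁τ₂τ₁τ₂ = τ₂τ₁τ₂τ₁τ₂τ₁). Then Y₁Y₂Y₁Y₂Y₁Y₂ − Y₂Y₁Y₂Y₁Y₂Y₁ = 4u·(Y₁Y₂Y₁Y₂ − Y₂Y₁Y₂Y₁) − 3u²·(Y₁Y₂ − Y₂Y₁). -/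
/-- If `a - t` and `b - t` satisfy the braid relation of type `G₂`, where `a² = (t + t⁻¹)a` and
`b² = (t + t⁻¹)b`, then `a` and `b` satisfy the twisted braid relation of type `G₂`. -/
theorem twisted_braid_of_braid {R A : Type*} [CommRing R] [Ring A] [Algebra R A]
    {t ti : R} (htt : t * ti = 1) {a b : A}
    (ha : a * a = (t + ti) • a) (hb : b * b = (t + ti) • b)
    (h : (a - t • 1) * (b - t • 1) * (a - t • 1) * (b - t • 1) * (a - t • 1) * (b - t • 1) =
      (b - t • 1) * (a - t • 1) * (b - t • 1) * (a - t • 1) * (b - t • 1) * (a - t • 1)) :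
    a * b * a * b * a * b - b * a * b * a * b * a =
      (4 : R) • (a * b * a * b - b * a * b * a) - (3 : R) • (a * b - b * a) := by
  simp only [sub_mul, mul_sub, mul_assoc, smul_mul_assoc, mul_smul_comm, one_mul, mul_one,
    ha, hb, smul_sub] at h ⊢
  rw [← sub_eq_zero] at h ⊢
  rw [← h]
  match_scalars <;> grind

/-- The twisted braid relation in type `G₂` for the push-pull elements of the
hyperbolic formal Demazure algebra:
`Y₁Y₂Y₁Y₂Y₁Y₂ − Y₂Y₁Y₂Y₁Y₂Y₁ = 4u·(Y₁Y₂Y₁Y₂ − Y₂Y₁Y₂Y₁) − 3u²·(Y₁Y₂ − Y₂Y₁)` where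
`u = c⁻² = ci·ci`. -/
theorem stmt12 {R A : Type*} [CommRing R] [Ring A] [Algebra R A]
    (t ti ci : R) (htt : t * ti = 1) (hci : (t + ti) * ci = 1)
    (τ₁ τ₂ : A)
    (hq1 : τ₁ ^ 2 = algebraMap R A (ti - t) * τ₁ + 1)
    (hq2 : τ₂ ^ 2 = algebraMap R A (ti - t) * τ₂ + 1)
    (hbraid : τ₁ * τ₂ * τ₁ * τ₂ * τ₁ * τ₂ = τ₂ * τ₁ * τ₂ * τ₁ * τ₂ * τ₁) :
    pushPull t ci τ₁ * pushPull t ci τ₂ * pushPull t ci τ₁ * pushPull t ci τ₂ *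
        pushPull t ci τ₁ * pushPull t ci τ₂
      - pushPull t ci τ₂ * pushPull t ci τ₁ * pushPull t ci τ₂ * pushPull t ci τ₁ *
        pushPull t ci τ₂ * pushPull t ci τ₁
      = 4 * algebraMap R A (ci * ci) *
          (pushPull t ci τ₁ * pushPull t ci τ₂ * pushPull t ci τ₁ * pushPull t ci τ₂
            - pushPull t ci τ₂ * pushPull t ci τ₁ * pushPull t ci τ₂ * pushPull t ci τ₁)
        - 3 * algebraMap R A (ci * ci) ^ 2 *
          (pushPull t ci τ₁ * pushPull t ci τ₂ - pushPull t ci τ₂ * pushPull t ci τ₁) := by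
  have hquad {τ : A} (hq : τ ^ 2 = algebraMap R A (ti - t) * τ + 1) :
      (τ + t • 1) * (τ + t • 1) = (t + ti) • (τ + t • 1) := by
    rw [sq, ← Algebra.smul_def] at hq
    simp only [add_mul, mul_add, smul_mul_assoc, mul_smul_comm, one_mul, mul_one, hq]
    match_scalars <;> grind
  have key := twisted_braid_of_braid htt (hquad hq1) (hquad hq2)
    (by simpa only [add_sub_cancel_right] using hbraid)
  have hY (τ : A) : pushPull t ci τ = ci • (τ + t • 1) := by
    rw [pushPull, ← Algebra.smul_def, Algebra.algebraMap_eq_smul_one]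
  have h4 : (4 : A) = algebraMap R A 4 := (map_ofNat _ 4).symm
  have h3 : (3 : A) = algebraMap R A 3 := (map_ofNat _ 3).symm
  rw [h4, h3, ← map_pow, ← map_mul, ← map_mul, ← Algebra.smul_def, ← Algebra.smul_def]
  simp only [hY, smul_mul_assoc, mul_smul_comm]
  linear_combination (norm := module) ci ^ 6 • key
end
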